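/- Let 2 ≤ i ≤ n and for each 1 ≤ j ≤ i−1 let V_j be a positive word whose letters lie among a_1, …, a_j. Then in the positive braid monoid B⁺_{n+1} one has a_i Λ_1 V_1 Λ_2 V_2 ⋯ Λ_{i−1} V_{i−1} Λ_i = Δ_i a_1 V_1^{(i−1)} V_2^{(i−2)} ⋯ V_{i−1}^{(1)}. -/

import Mathlib

/-- Defining relations of the braid monoid/group on `n` strands' generators `Fin n`
(generator `i : Fin n` represents the Artin generator `a_{i+1}`):
braid relations `a_{i+1} a_i a_{i+1} = a_i a_{i+1} a_i` and
commutation `a_k a_s = a_s a_k` for `k - s ≥ 2`. -/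
def braidRels (n : ℕ) : FreeMonoid (Fin n) → FreeMonoid (Fin n) → Prop := fun x y =>
  (∃ i j : Fin n, (i : ℕ) + 1 = j ∧
      x = .of j * .of i * .of j ∧ y = .of i * .of j * .of i) ∨
  (∃ i j : Fin n, (i : ℕ) + 2 ≤ j ∧
      x = .of j * .of i ∧ y = .of i * .of j)

/-- The positive braid monoid `B⁺_{n+1}`. -/
def BraidMonoid (n : ℕ) : Type := PresentedMonoid (braidRels n)

instance (n : ℕ) : Monoid (BraidMonoid n) :=
  inferInstanceAs (Monoid (PresentedMonoid (braidRels n)))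

/-- Relators of the braid group `B_{n+1}` on generators `Fin n`. -/
def braidRelators (n : ℕ) : Set (FreeGroup (Fin n)) :=
  {r | (∃ i j : Fin n, (i : ℕ) + 1 = j ∧
          r = .of j * .of i * .of j * (.of i * .of j * .of i)⁻¹) ∨
       (∃ i j : Fin n, (i : ℕ) + 2 ≤ j ∧
          r = .of j * .of i * (.of i * .of j)⁻¹)}

/-- The braid group `B_{n+1}`. -/
def BraidGroup (n : ℕ) : Type := PresentedGroup (braidRelators n)

instance (n : ℕ) : Group (BraidGroup n) :=
  inferInstanceAs (Group (PresentedGroup (braidRelators n)))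

namespace Braid

/-- The Artin generator `a_i` (`1 ≤ i ≤ n`) of the positive braid monoid;
junk value `1` outside this range. -/
def a (n i : ℕ) : BraidMonoid n :=
  if h : 1 ≤ i ∧ i ≤ n then PresentedMonoid.of (braidRels n) ⟨i - 1, by omega⟩ else 1

/-- The Artin generator `a_i` (`1 ≤ i ≤ n`) of the braid group; junk value `1` otherwise. -/
def b (n i : ℕ) : BraidGroup n :=
  if h : 1 ≤ i ∧ i ≤ n then PresentedGroup.of (rels := braidRelators n) ⟨i - 1, by omega⟩ else 1

/-- The element of `B⁺_{n+1}` given by a positive word, i.e. a list of indices of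
Artin generators. -/
def w (n : ℕ) (L : List ℕ) : BraidMonoid n := (L.map (a n)).prod

/-- The element of `B_{n+1}` given by a positive word. -/
def wG (n : ℕ) (L : List ℕ) : BraidGroup n := (L.map (b n)).prod

/-- `Λ_i = a_i a_{i-1} ⋯ a_1`. -/
def Lam (n i : ℕ) : BraidMonoid n := ((List.range i).reverse.map (fun m => a n (m + 1))).prod

/-- `Λ_i^{(−)} = a_i a_{i-1} ⋯ a_2`  (`Λ_1^{(−)} = 1`). -/
def LamM (n i : ℕ) : BraidMonoid n :=
  ((List.range (i - 1)).reverse.map (fun m => a n (m + 2))).prod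

/-- `Λ_i^{(−−)} = a_i a_{i-1} ⋯ a_3`  (`Λ_2^{(−−)} = 1`). -/
def LamMM (n i : ℕ) : BraidMonoid n :=
  ((List.range (i - 2)).reverse.map (fun m => a n (m + 3))).prod

/-- `Δ_i = Λ_1 Λ_2 ⋯ Λ_i`. -/
def DeltaI (n i : ℕ) : BraidMonoid n := ((List.range i).map (fun m => Lam n (m + 1))).prod

/-- The Garside element `Δ = Λ_1 Λ_2 ⋯ Λ_n`. -/
def Delta (n : ℕ) : BraidMonoid n := DeltaI n n

/-- `Λ_i` in the braid group. -/
def LamG (n i : ℕ) : BraidGroup n := ((List.range i).reverse.map (fun m => b n (m + 1))).prod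

/-- `Δ_i = Λ_1 Λ_2 ⋯ Λ_i` in the braid group. -/
def DeltaIG (n i : ℕ) : BraidGroup n := ((List.range i).map (fun m => LamG n (m + 1))).prod

/-- The descending run `a_{ij} = a_i a_{i-1} ⋯ a_j` (`j ≤ i`), with `a_{i,i+1} = 1`. -/
def run (n i j : ℕ) : BraidMonoid n :=
  ((List.range (i + 1 - j)).reverse.map (fun m => a n (m + j))).prod

end Braid

namespace Braid

theorem a_eq {n i : ℕ} (h : 1 ≤ i ∧ i ≤ n) :
    a n i = PresentedMonoid.of (braidRels n) ⟨i - 1, by omega⟩ :=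
  dif_pos h

theorem a_mul_a_comm {n s k : ℕ} (hs : 1 ≤ s) (hk : s + 2 ≤ k) (hn : k ≤ n) :
    a n k * a n s = a n s * a n k := by
  rw [a_eq (by omega : 1 ≤ k ∧ k ≤ n), a_eq (by omega : 1 ≤ s ∧ s ≤ n)]
  exact PresentedMonoid.mk_eq_mk_of_rel (rels := braidRels n)
    (Or.inr ⟨⟨s - 1, by omega⟩, ⟨k - 1, by omega⟩, by grind, rfl, rfl⟩)

theorem a_braid {n m : ℕ} (hm : 1 ≤ m) (hn : m + 1 ≤ n) :
    a n (m + 1) * a n m * a n (m + 1) = a n m * a n (m + 1) * a n m := by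
  rw [a_eq (by omega : 1 ≤ m + 1 ∧ m + 1 ≤ n), a_eq (by omega : 1 ≤ m ∧ m ≤ n)]
  exact PresentedMonoid.mk_eq_mk_of_rel (rels := braidRels n)
    (Or.inl ⟨⟨m - 1, by omega⟩, ⟨m, by omega⟩, by grind, rfl, rfl⟩)

@[simp]
theorem w_nil (n : ℕ) : w n [] = 1 := by simp [w]

@[simp]
theorem w_cons (n m : ℕ) (L : List ℕ) : w n (m :: L) = a n m * w n L := by simp [w]

@[simp]
theorem w_append (n : ℕ) (L M : List ℕ) : w n (L ++ M) = w n L * w n M := by simp [w]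

theorem w_flatMap (n : ℕ) (L : List ℕ) (f : ℕ → List ℕ) :
    w n (L.flatMap f) = (L.map fun t => w n (f t)).prod := by
  induction L with
  | nil => simp
  | cons x L ih => simp [ih]

theorem Lam_zero (n : ℕ) : Lam n 0 = 1 := by simp [Lam]

theorem Lam_succ (n i : ℕ) : Lam n (i + 1) = a n (i + 1) * Lam n i := by
  simp [Lam, List.range_succ]

theorem DeltaI_zero (n : ℕ) : DeltaI n 0 = 1 := by simp [DeltaI]

theorem DeltaI_succ (n i : ℕ) : DeltaI n (i + 1) = DeltaI n i * Lam n (i + 1) := by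
  simp [DeltaI, List.range_succ]

theorem Lam_eq_w (n i : ℕ) : Lam n i = w n ((List.range i).reverse.map (· + 1)) := by
  simp [Lam, w, Function.comp_def]

theorem Lam_succ_eq_w_mul (n i : ℕ) :
    Lam n (i + 1) = w n (((List.range i).reverse.map (· + 1)).map (· + 1)) * a n 1 := by
  induction i with
  | zero => simp [Lam]
  | succ i ih =>
    rw [Lam_succ, ih]
    simp [List.range_succ, mul_assoc]

/-- A generator commutes with every `Λ_j` of sufficiently smaller index. -/
theorem a_mul_Lam_comm {n k j : ℕ} (hj : j + 2 ≤ k) (hn : k ≤ n) :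
    a n k * Lam n j = Lam n j * a n k := by
  induction j with
  | zero => simp [Lam_zero]
  | succ j ih =>
    rw [Lam_succ, ← mul_assoc, a_mul_a_comm (by omega) (by omega) hn, mul_assoc,
      ih (by omega), mul_assoc]

/-- Moving a generator across `Λ_i` raises its index by one. -/
theorem a_mul_Lam {n m i : ℕ} (hm : 1 ≤ m) (hi : m < i) (hn : i ≤ n) :
    a n m * Lam n i = Lam n i * a n (m + 1) := by
  induction i, hi using Nat.le_induction with
  | base =>
    obtain ⟨m, rfl⟩ : ∃ r, m = r + 1 := ⟨m - 1, by omega⟩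
    calc a n (m + 1) * Lam n (m + 1 + 1)
        = a n (m + 1) * a n (m + 1 + 1) * a n (m + 1) * Lam n m := by
          simp only [Lam_succ, mul_assoc]
      _ = a n (m + 1 + 1) * a n (m + 1) * (a n (m + 1 + 1) * Lam n m) := by
          rw [← a_braid hm hn, mul_assoc _ _ (Lam n m)]
      _ = Lam n (m + 1 + 1) * a n (m + 1 + 1) := by
          rw [a_mul_Lam_comm (by omega) hn]
          simp only [Lam_succ, mul_assoc]
  | succ i hi ih =>
    rw [Lam_succ, ← mul_assoc, ← a_mul_a_comm hm (by omega) hn, mul_assoc, ih (by omega),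
      mul_assoc]

/-- Moving a word across `Λ_i` raises all its indices by one. -/
theorem w_mul_Lam {n i : ℕ} (hn : i ≤ n) (L : List ℕ) (hL : ∀ m ∈ L, 1 ≤ m ∧ m < i) :
    w n L * Lam n i = Lam n i * w n (L.map (· + 1)) := by
  induction L with
  | nil => simp
  | cons x L ih =>
    have hx := hL x (by simp)
    rw [w_cons, mul_assoc, ih fun m hm => hL m (by simp [hm]), ← mul_assoc,
      a_mul_Lam hx.1 hx.2 hn, mul_assoc, List.map_cons, w_cons]

theorem Lam_succ_mul_self {n i : ℕ} (hn : i + 1 ≤ n) :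
    Lam n (i + 1) * Lam n (i + 1) = Lam n i * Lam n (i + 1) * a n 1 := by
  conv_lhs => arg 2; rw [Lam_succ_eq_w_mul]
  rw [← mul_assoc, ← w_mul_Lam hn, ← Lam_eq_w]
  intro m hm
  simp only [List.mem_map, List.mem_reverse, List.mem_range] at hm
  omega

theorem a_mul_DeltaI_comm {n k j : ℕ} (hj : j + 2 ≤ k) (hn : k ≤ n) :
    a n k * DeltaI n j = DeltaI n j * a n k := by
  induction j with
  | zero => simp [DeltaI_zero]
  | succ j ih =>
    rw [DeltaI_succ, ← mul_assoc, ih (by omega), mul_assoc, a_mul_Lam_comm hj hn, mul_assoc]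

theorem a_mul_DeltaI {n i : ℕ} (hi : 1 ≤ i) (hn : i ≤ n) :
    a n i * DeltaI n i = DeltaI n i * a n 1 := by
  obtain _ | _ | i := i
  · omega
  · simp [DeltaI, Lam]
  · rw [DeltaI_succ, DeltaI_succ, ← mul_assoc, ← mul_assoc, a_mul_DeltaI_comm (by omega) hn,
      mul_assoc (DeltaI n i), ← Lam_succ, mul_assoc, Lam_succ_mul_self hn]
    simp only [mul_assoc]

theorem interleaved_prod_mul_Lam {n k : ℕ} (hk : k + 1 ≤ n) (Vs : ℕ → List ℕ)
    (hVs : ∀ j, 1 ≤ j → j ≤ k → ∀ m ∈ Vs j, 1 ≤ m ∧ m ≤ j) :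
    ((List.range k).map (fun t => Lam n (t + 1) * w n (Vs (t + 1)))).prod * Lam n (k + 1)
      = DeltaI n (k + 1) *
        w n ((List.range k).flatMap fun t => (Vs (t + 1)).map (· + (k - t))) := by
  induction k with
  | zero => simp [DeltaI]
  | succ k ih =>
    have hshift : ((List.range (k + 1)).flatMap fun t => (Vs (t + 1)).map (· + (k + 1 - t)))
        = (((List.range k).flatMap fun t => (Vs (t + 1)).map (· + (k - t))) ++
            Vs (k + 1)).map (· + 1) := by
      rw [List.range_succ, List.flatMap_append, List.map_append, List.map_flatMap]
      congr 1
      · refine List.flatMap_congr fun t ht => ?_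
        rw [List.mem_range] at ht
        rw [List.map_map]
        refine List.map_congr_left fun m _ => ?_
        simp only [Function.comp_apply]
        omega
      · simp
    rw [hshift, DeltaI_succ n (k + 1), mul_assoc, ← w_mul_Lam hk, w_append, ← mul_assoc,
      ← mul_assoc, ← ih (by omega) fun j h1 h2 => hVs j h1 (by omega)]
    · simp [List.range_succ, mul_assoc]
    · intro m hm
      simp only [List.mem_append, List.mem_flatMap, List.mem_range, List.mem_map] at hm
      obtain ⟨t, ht, r, hr, rfl⟩ | hm := hm
      · have := hVs (t + 1) (by omega) (by omega) r hr
        omega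
      · have := hVs (k + 1) (by omega) le_rfl m hm
        omega

end Braid

/-- For `2 ≤ i ≤ n` and positive words `V_j` in the letters `a_1, …, a_j`
(for `1 ≤ j ≤ i−1`), in the positive braid monoid `B⁺_{n+1}` one has
`a_i Λ_1 V_1 Λ_2 V_2 ⋯ Λ_{i−1} V_{i−1} Λ_i = Δ_i a_1 V_1^{(i−1)} V_2^{(i−2)} ⋯ V_{i−1}^{(1)}`. -/
theorem a_mul_interleaved_prod (n i : ℕ) (hi1 : 2 ≤ i) (hi2 : i ≤ n) (Vs : ℕ → List ℕ)
    (hVs : ∀ j, 1 ≤ j → j ≤ i - 1 → ∀ m ∈ Vs j, 1 ≤ m ∧ m ≤ j) :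
    Braid.a n i *
        ((List.range (i - 1)).map (fun t => Braid.Lam n (t + 1) * Braid.w n (Vs (t + 1)))).prod *
        Braid.Lam n i
      = Braid.DeltaI n i * Braid.a n 1 *
        ((List.range (i - 1)).map
            (fun t => Braid.w n ((Vs (t + 1)).map (· + (i - 1 - t))))).prod := by
  obtain ⟨k, rfl⟩ : ∃ k, i = k + 1 := ⟨i - 1, by omega⟩
  rw [Nat.add_sub_cancel] at hVs ⊢
  rw [mul_assoc, Braid.interleaved_prod_mul_Lam hi2 Vs hVs, ← mul_assoc,
    Braid.a_mul_DeltaI (by omega) hi2, Braid.w_flatMap]
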